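/- Let π be a juggling function of period n with h balls and let C be a π-frieze over a field 𝕜. For each b ∈ ℤ with b < π(b), let x^{(b)} : ℤ → 𝕜 be the unique sequence with x^{(b)}_a = (−1)^{a+b}·C†_{a,b} for b ≤ a < b + n and x^{(b)}_{a+n} = (−1)^{n−h−1}·x^{(b)}_a for all a ∈ ℤ. Then C·x^{(b)} = 0 for every such b, and the 𝕜-linear span of the sequences { x^{(b)} : b ∈ ℤ, b < π(b) } equals the space of all sequences x : ℤ → 𝕜 with Cx = 0. -/

import Mathlib

open Finset

variable {K : Type*} [Field K]

/-- A juggling function of period `n`: a bijection `π : ℤ → ℤ` with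
`i ≤ π i ≤ i + n` and `π (i + n) = π i + n` for all `i`. -/
structure IsJuggling (n : ℕ) (π : ℤ ≃ ℤ) : Prop where
  npos : 0 < n
  le_self : ∀ i : ℤ, i ≤ π i
  le_add : ∀ i : ℤ, π i ≤ i + n
  periodic : ∀ i : ℤ, π (i + n) = π i + n

/-- The juggling function `π` of period `n` has `h` balls. -/
def HasBalls (n : ℕ) (π : ℤ ≃ ℤ) (h : ℕ) : Prop :=
  ∑ i ∈ Finset.Icc (1 : ℤ) (n : ℤ), (π i - i) = (h : ℤ) * n

/-- The dual juggling function `π†`, `a ↦ π⁻¹ a + n`. -/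
def dualJug (n : ℕ) (π : ℤ ≃ ℤ) : ℤ ≃ ℤ :=
  π.symm.trans (Equiv.addRight (n : ℤ))

/-- A `π`-prefrieze: `C a b = 1` if `a = b`; `C a b = (-1)^|S_π(b,a)|` if `a = π b`;
and `C a b = 0` whenever `a ∉ [b, π b]` or `b ∉ [π⁻¹ a, a]`. -/
def IsPrefrieze (π : ℤ ≃ ℤ) (C : ℤ → ℤ → K) : Prop :=
  ∀ a b : ℤ,
    (a = b → C a b = 1) ∧
    (a = π b → C a b = (-1 : K) ^ Set.ncard {i : ℤ | b < i ∧ π i < a}) ∧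
    (¬(b ≤ a ∧ a ≤ π b) ∨ ¬(π.symm a ≤ b ∧ b ≤ a) → C a b = 0)

/-- The determinant of the square submatrix of the `ℤ×ℤ` matrix `C` with rows indexed
by `I` and columns by `J`, each taken in increasing order (junk value `0` if the
cardinalities differ). -/
noncomputable def minor (C : ℤ → ℤ → K) (I J : Finset ℤ) : K :=
  if h : J.card = I.card then
    Matrix.det (Matrix.of fun i j : Fin I.card =>
      C (I.orderEmbOfFin rfl i) (J.orderEmbOfFin h j))
  else 0

/-- A `π`-frieze: a `π`-prefrieze satisfying the frieze and tameness conditions. -/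
def IsFrieze (n : ℕ) (π : ℤ ≃ ℤ) (C : ℤ → ℤ → K) : Prop :=
  IsPrefrieze π C ∧
  -- the frieze condition
  (∀ a b : ℤ, dualJug n π a ≤ b → b < a + n → a + n ≤ π b →
    minor C
      (Finset.Icc a b \ (Finset.Icc a b).filter (fun i => dualJug n π i ≤ b))
      (Finset.Icc a b \
        ((Finset.Icc a b).filter (fun i => dualJug n π i ≤ b)).image (dualJug n π)) = 1) ∧
  -- the tameness condition
  (∀ a b : ℤ, (dualJug n π a < b ∧ b < a + n) ∨ (b < a + n ∧ a + n < π b) →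
    minor C
      (Finset.Ioc a b \ (Finset.Ioo a b).filter (fun i => dualJug n π i < b))
      (Finset.Ico a b \
        ((Finset.Ioo a b).filter (fun i => dualJug n π i < b)).image (dualJug n π)) = 0)

/-- The dual `C†` of a `π`-prefrieze `C` (for `π` of period `n` with `h` balls). -/
noncomputable def dualMat (n h : ℕ) (π : ℤ ≃ ℤ) (C : ℤ → ℤ → K) : ℤ → ℤ → K :=
  fun a b =>
    if b ≤ a ∧ a < b + n then minor C (Finset.Icc (b + 1) a) (Finset.Icc b (a - 1))
    else if π b = b ∧ a = b + n then (-1 : K) ^ ((h : ℤ) - 1)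
    else 0

/-- The sequence `x : ℤ → K` solves the linear recurrence `C x = 0`:
each row of `C` has finitely many nonzero entries, and the (finite) sum
`∑_b C a b * x b` vanishes for every `a`. -/
def SolvesRec (C : ℤ → ℤ → K) (x : ℤ → K) : Prop :=
  ∀ a : ℤ, ∑ᶠ b : ℤ, C a b * x b = 0

lemma minor_eq (C : ℤ → ℤ → K) (I J : Finset ℤ) (k : ℕ) (hI : I.card = k) (hJ : J.card = k) :
    minor C I J = Matrix.det (Matrix.of fun i j : Fin k =>
      C (I.orderEmbOfFin hI i) (J.orderEmbOfFin hJ j)) := by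
  subst hI
  simp [minor, hJ]

lemma pos_card (R : Finset ℤ) (k : ℕ) (hR : R.card = k) (i : Fin k) :
    (R.filter (fun x => x < R.orderEmbOfFin hR i)).card = (i : ℕ) := by
  have : R.filter (fun x => x < R.orderEmbOfFin hR i)
      = (Finset.Iio i).map (R.orderEmbOfFin hR).toEmbedding := by
    ext x
    simp only [Finset.mem_filter, Finset.mem_map, Finset.mem_Iio]
    constructor
    · rintro ⟨hx, hlt⟩
      have : x ∈ Set.range (R.orderEmbOfFin hR) := by
        rw [Finset.range_orderEmbOfFin]; exact hx
      obtain ⟨j, rfl⟩ := this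
      exact ⟨j, by simpa using hlt, rfl⟩
    · rintro ⟨j, hj, rfl⟩
      exact ⟨Finset.orderEmbOfFin_mem R hR j, by simpa using hj⟩
  rw [this, Finset.card_map, Fin.card_Iio]

lemma erase_emb (R : Finset ℤ) (k : ℕ) (hR : R.card = k + 1) (i : Fin (k+1))
    (hE : (R.erase (R.orderEmbOfFin hR i)).card = k) (j : Fin k) :
    R.orderEmbOfFin hR (i.succAbove j) = (R.erase (R.orderEmbOfFin hR i)).orderEmbOfFin hE j := by
  have := Finset.orderEmbOfFin_unique hE (f := fun j => R.orderEmbOfFin hR (i.succAbove j))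
    (fun x => by
      refine Finset.mem_erase.2 ⟨?_, Finset.orderEmbOfFin_mem R hR _⟩
      intro h
      exact Fin.succAbove_ne i x ((R.orderEmbOfFin hR).injective h))
    (fun x y hxy => (R.orderEmbOfFin hR).strictMono (Fin.strictMono_succAbove i hxy))
  exact congrFun this j

lemma laplace (M : ℤ → ℤ → K) (R S : Finset ℤ) (hRS : S.card = R.card) (r c : ℤ)
    (hr : r ∈ R) (hc : c ∈ S) (h1 : M r c = 1) (h0 : ∀ x ∈ R, x ≠ r → M x c = 0) :
    minor M R S = (-1 : K) ^ ((R.filter (· < r)).card + (S.filter (· < c)).card) *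
      minor M (R.erase r) (S.erase c) := by
  obtain ⟨k, hk⟩ : ∃ k, R.card = k + 1 := ⟨R.card - 1, by
    have := Finset.card_pos.2 ⟨r, hr⟩; omega⟩
  have hS : S.card = k + 1 := by omega
  obtain ⟨i, rfl⟩ : ∃ i, R.orderEmbOfFin hk i = r := by
    have : r ∈ Set.range (R.orderEmbOfFin hk) := by
      rw [Finset.range_orderEmbOfFin]; exact hr
    exact this
  obtain ⟨j, rfl⟩ : ∃ i, S.orderEmbOfFin hS i = c := by
    have : c ∈ Set.range (S.orderEmbOfFin hS) := by
      rw [Finset.range_orderEmbOfFin]; exact hc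
    exact this
  have hRe : (R.erase (R.orderEmbOfFin hk i)).card = k := by
    rw [Finset.card_erase_of_mem hr]; omega
  have hSe : (S.erase (S.orderEmbOfFin hS j)).card = k := by
    rw [Finset.card_erase_of_mem hc]; omega
  rw [pos_card, pos_card, minor_eq M R S (k+1) hk hS, Matrix.det_succ_column _ j,
    Finset.sum_eq_single i, minor_eq M _ _ k hRe hSe]
  · simp only [Matrix.of_apply, h1, mul_one]
    congr 2
    ext x y
    simp only [Matrix.submatrix_apply, Matrix.of_apply]
    rw [erase_emb, erase_emb]
  · intro b _ hb
    rw [Matrix.of_apply, h0 _ (Finset.orderEmbOfFin_mem R hk b)]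
    · ring
    · intro h; exact hb ((R.orderEmbOfFin hk).injective h)
  · simp

lemma minor_self (M : ℤ → ℤ → K) (U : Finset ℤ) :
    minor M U U = Matrix.det (Matrix.of fun i j : U => M i j) := by
  rw [minor_eq M U U U.card rfl rfl]
  rw [← Matrix.det_submatrix_equiv_self (U.orderIsoOfFin rfl).toEquiv]
  rfl

lemma nz_eq {k l : ℤ} (h : Even (k - l)) : (-1 : K) ^ k = (-1 : K) ^ l := by
  have h1 : (-1 : K) ^ (k - l) = 1 := h.neg_one_zpow
  rw [zpow_sub₀ (by simp)] at h1
  have : (-1 : K) ^ l ≠ 0 := zpow_ne_zero _ (by simp)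
  field_simp at h1
  exact h1

/-- column-replaced matrix -/
def repl (C : ℤ → ℤ → K) (f : ℤ → ℤ) (I : Finset ℤ) : ℤ → ℤ → K :=
  fun r c => if c ∈ I.image f then (if r ∈ I ∧ f r = c then 1 else 0) else C r c

lemma minor_congr (M N : ℤ → ℤ → K) (R S : Finset ℤ) (h : ∀ r ∈ R, ∀ c ∈ S, M r c = N r c) :
    minor M R S = minor N R S := by
  unfold minor
  split_ifs with hh
  · congr 1
    ext i j
    exact h _ (Finset.orderEmbOfFin_mem _ _ _) _ (Finset.orderEmbOfFin_mem _ _ _)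
  · rfl

lemma repl_expand (C : ℤ → ℤ → K) (f : ℤ → ℤ) (a b : ℤ) (I : Finset ℤ)
    (hI : I ⊆ Finset.Icc a b) (hf : Set.InjOn f I) (hfI : ∀ i ∈ I, f i ∈ Finset.Icc a b)
    (P : Finset ℤ) : P ⊆ I →
    minor (repl C f I) (Finset.Icc a b) (Finset.Icc a b) =
      (∏ i ∈ P, (-1 : K) ^ (f i - i + ((P.filter (fun k => i < k ∧ f k < f i)).card : ℤ))) *
      minor (repl C f I) (Finset.Icc a b \ P) (Finset.Icc a b \ P.image f) := by
  induction P using Finset.induction_on_min with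
  | empty => simp
  | insert i P hlt ih =>
    intro hP
    have hiI : i ∈ I := hP (Finset.mem_insert_self _ _)
    have hPI : P ⊆ I := fun x hx => hP (Finset.mem_insert_of_mem hx)
    have hiP : i ∉ P := fun h => lt_irrefl _ (hlt i h)
    have hfP : Set.InjOn f P := hf.mono (by exact_mod_cast hPI)
    have hiU := Finset.mem_Icc.1 (hI hiI)
    have hfiU := Finset.mem_Icc.1 (hfI i hiI)
    have himU : P.image f ⊆ Finset.Icc a b := by
      intro x hx
      obtain ⟨k, hk, rfl⟩ := Finset.mem_image.1 hx
      exact hfI k (hPI hk)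
    have hfi : f i ∉ P.image f := by
      intro hx
      obtain ⟨k, hk, he⟩ := Finset.mem_image.1 hx
      exact hiP (hf (hPI hk) hiI he ▸ hk)
    rw [ih hPI, laplace (repl C f I) _ _ ?_ i (f i)]
    rotate_left
    · exact Finset.mem_sdiff.2 ⟨hI hiI, hiP⟩
    · exact Finset.mem_sdiff.2 ⟨hfI i hiI, hfi⟩
    · simp only [repl]
      rw [if_pos (Finset.mem_image_of_mem f hiI), if_pos ⟨hiI, trivial⟩]
    · intro x hx hne
      simp only [repl]
      rw [if_pos (Finset.mem_image_of_mem f hiI), if_neg]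
      rintro ⟨h1, h2⟩
      exact hne (hf h1 hiI h2)
    · rw [Finset.card_sdiff_of_subset himU, Finset.card_sdiff_of_subset (hPI.trans hI),
        Finset.card_image_of_injOn hfP]
    have e1 : (Finset.Icc a b \ P).erase i = Finset.Icc a b \ insert i P := by
      ext x; simp only [Finset.mem_erase, Finset.mem_sdiff, Finset.mem_insert]; tauto
    have e2 : (Finset.Icc a b \ P.image f).erase (f i)
        = Finset.Icc a b \ (insert i P).image f := by
      ext x
      simp only [Finset.mem_erase, Finset.mem_sdiff, Finset.mem_insert, Finset.image_insert]
      tauto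
    rw [e1, e2, ← mul_assoc]
    congr 1
    rw [Finset.prod_insert hiP, mul_comm]
    congr 1
    · have c1 : (((Finset.Icc a b \ P).filter (· < i)).card : ℤ) = i - a := by
        have : (Finset.Icc a b \ P).filter (· < i) = Finset.Ico a i := by
          ext x
          simp only [Finset.mem_filter, Finset.mem_sdiff, Finset.mem_Icc, Finset.mem_Ico]
          constructor
          · rintro ⟨⟨h1, h2⟩, h3⟩; omega
          · rintro ⟨h1, h2⟩
            refine ⟨⟨by omega, fun h => ?_⟩, h2⟩
            have := hlt x h
            omega
        rw [this, Int.card_Ico]; omega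
      have c2 : (((Finset.Icc a b \ P.image f).filter (· < f i)).card : ℤ)
          + ((P.filter (fun k => f k < f i)).card : ℤ) = f i - a := by
        have h1 : (P.filter (fun k => f k < f i)).card
            = ((P.filter (fun k => f k < f i)).image f).card := by
          rw [Finset.card_image_of_injOn]
          exact hfP.mono (by intro x hx; exact (Finset.mem_filter.1 hx).1)
        rw [h1, ← Nat.cast_add, ← Finset.card_union_of_disjoint]
        · have : (Finset.Icc a b \ P.image f).filter (· < f i)
              ∪ (P.filter (fun k => f k < f i)).image f = Finset.Ico a (f i) := by
            ext x
            simp only [Finset.mem_union, Finset.mem_filter, Finset.mem_sdiff, Finset.mem_Icc,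
              Finset.mem_Ico, Finset.mem_image]
            constructor
            · rintro (⟨⟨h1, h2⟩, h3⟩ | ⟨k, ⟨hk, hk2⟩, rfl⟩)
              · omega
              · have := Finset.mem_Icc.1 (hfI k (hPI hk)); omega
            · rintro ⟨h1, h2⟩
              by_cases hx : ∃ k ∈ P, f k = x
              · right
                obtain ⟨k, hk, rfl⟩ := hx
                exact ⟨k, ⟨hk, h2⟩, rfl⟩
              · left
                exact ⟨⟨by omega, hx⟩, h2⟩
          rw [this, Int.card_Ico]; omega
        · rw [Finset.disjoint_left]
          intro x hx hx2
          obtain ⟨k, hk, rfl⟩ := Finset.mem_image.1 hx2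
          have h3 := (Finset.mem_sdiff.1 (Finset.mem_filter.1 hx).1).2
          exact h3 (Finset.mem_image_of_mem f (Finset.mem_filter.1 hk).1)
      have c3 : (insert i P).filter (fun k => i < k ∧ f k < f i)
          = P.filter (fun k => f k < f i) := by
        ext x
        simp only [Finset.mem_filter, Finset.mem_insert]
        constructor
        · rintro ⟨rfl | h, h2, h3⟩
          · omega
          · exact ⟨h, h3⟩
        · rintro ⟨h, h3⟩
          exact ⟨Or.inr h, hlt x h, h3⟩
      rw [c3, ← zpow_natCast]
      apply nz_eq
      push_cast
      refine ⟨i - a - ((P.filter (fun k => f k < f i)).card : ℤ), ?_⟩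
      omega
    · apply Finset.prod_congr rfl
      intro j hj
      have hij := hlt j hj
      congr 4
      ext x
      simp only [Finset.mem_filter, Finset.mem_insert]
      constructor
      · rintro ⟨h, h2⟩; exact ⟨Or.inr h, h2⟩
      · rintro ⟨rfl | h, h2, h3⟩
        · omega
        · exact ⟨h, h2, h3⟩

lemma jacobi (C A : ℤ → ℤ → K) (f : ℤ → ℤ) (a b : ℤ) (I : Finset ℤ)
    (hI : I ⊆ Finset.Icc a b) (hf : Set.InjOn f I) (hfI : ∀ i ∈ I, f i ∈ Finset.Icc a b)
    (hA0 : ∀ r c, r < c → A r c = 0) (hA1 : ∀ r, A r r = 1)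
    (hAC : ∀ s ∈ Finset.Icc a b, ∀ c ∈ Finset.Icc a b,
      ∑ r ∈ Finset.Icc a b, A s r * C r c = if s = c then 1 else 0)
    (hup : ∀ i ∈ I, ∀ r ∈ Finset.Icc a b, f i < r → A r i = 0) :
    ∏ i ∈ I, A (f i) i =
      (∏ i ∈ I, (-1 : K) ^ (f i - i + ((I.filter (fun k => i < k ∧ f k < f i)).card : ℤ))) *
      minor C (Finset.Icc a b \ I) (Finset.Icc a b \ I.image f) := by
  set U := Finset.Icc a b with hU
  have h1 := repl_expand C f a b I hI hf hfI I (Finset.Subset.refl _)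
  rw [← hU] at h1
  rw [minor_congr (repl C f I) C (U \ I) (U \ I.image f)] at h1
  swap
  · intro r hr c hc
    simp only [repl]
    rw [if_neg (Finset.mem_sdiff.1 hc).2]
  rw [← h1, minor_self]
  have hdA : Matrix.det (Matrix.of fun i j : U => A i j) = 1 := by
    rw [Matrix.det_of_isLowerTriangular]
    · simp [hA1]
    · intro i j hij
      exact hA0 _ _ (by simpa using hij)
  -- the entries of the product
  have hN1 : ∀ r ∈ U, ∀ c ∈ U, c ∉ I.image f →
      ∑ k ∈ U, A r k * repl C f I k c = if r = c then 1 else 0 := by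
    intro r hr c hc hcI
    rw [← hAC r hr c hc]
    apply Finset.sum_congr rfl
    intro k _
    simp only [repl]
    rw [if_neg hcI]
  have hN2 : ∀ r ∈ U, ∀ i ∈ I, ∑ k ∈ U, A r k * repl C f I k (f i) = A r i := by
    intro r hr i hi
    rw [Finset.sum_eq_single i]
    · simp only [repl]
      rw [if_pos (Finset.mem_image_of_mem f hi), if_pos ⟨hi, trivial⟩, mul_one]
    · intro k _ hk
      simp only [repl]
      rw [if_pos (Finset.mem_image_of_mem f hi), if_neg, mul_zero]
      rintro ⟨h1, h2⟩
      exact hk (hf h1 hi h2)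
    · intro h; exact absurd (hI hi) h
  set N : ℤ → ℤ → K := fun r c => ∑ k ∈ U, A r k * repl C f I k c with hN
  have hprod : (Matrix.of fun i j : U => A i j) * (Matrix.of fun i j : U => repl C f I i j)
      = Matrix.of fun i j : U => N i j := by
    ext i j
    simp only [Matrix.mul_apply, Matrix.of_apply, hN]
    exact Finset.sum_coe_sort U (fun k => A i k * repl C f I k j)
  have hdet := congrArg Matrix.det hprod
  rw [Matrix.det_mul, hdA, one_mul] at hdet
  rw [hdet, Matrix.det_of_isUpperTriangular]
  · simp only [Matrix.of_apply]
    rw [Finset.prod_coe_sort U (fun c => N c c)]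
    have hsub : I.image f ⊆ U := by
      intro x hx
      obtain ⟨k, hk, rfl⟩ := Finset.mem_image.1 hx
      exact hfI k hk
    rw [← Finset.prod_subset hsub]
    · rw [Finset.prod_image hf]
      apply Finset.prod_congr rfl
      intro i hi
      exact (hN2 _ (hfI i hi) i hi).symm
    · intro c hc hcI
      simp only [hN]
      rw [hN1 c hc c hc hcI, if_pos rfl]
  · intro r c hrc
    have hrc' : (c : ℤ) < r := by simpa using hrc
    simp only [Matrix.of_apply]
    by_cases hc : (c : ℤ) ∈ I.image f
    · obtain ⟨i, hi, he⟩ := Finset.mem_image.1 hc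
      simp only [hN]
      rw [← he, hN2 _ r.2 i hi]
      exact hup i hi _ r.2 (by omega)
    · simp only [hN]
      rw [hN1 _ r.2 _ c.2 hc, if_neg (by omega)]

noncomputable def recSeq (p : ℤ) (y : ℤ → K) (F : ℤ → (ℤ → K) → K) (a : ℤ) : K :=
  if _h : a < p then y a else F a (fun c => if _hc : c < a then recSeq p y F c else 0)
termination_by (a - p + 1).toNat
decreasing_by omega

lemma exists_rec (p : ℤ) (y : ℤ → K) (F : ℤ → (ℤ → K) → K)
    (hF : ∀ a x x', (∀ c < a, x c = x' c) → F a x = F a x') :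
    ∃ x : ℤ → K, (∀ a < p, x a = y a) ∧ ∀ a, p ≤ a → x a = F a x := by
  refine ⟨recSeq p y F, ?_, ?_⟩
  · intro a ha
    rw [recSeq, dif_pos ha]
  · intro a ha
    rw [recSeq, dif_neg (by omega)]
    apply hF
    intro c hc
    rw [dif_pos hc]

/-- lower unitriangular inverse pair -/
structure InvP (C A : ℤ → ℤ → K) : Prop where
  C0 : ∀ r c, r < c → C r c = 0
  C1 : ∀ r, C r r = 1
  A0 : ∀ r c, r < c → A r c = 0
  A1 : ∀ r, A r r = 1
  CA : ∀ r c lo, lo ≤ c → ∑ k ∈ Finset.Icc lo r, C r k * A k c = if r = c then 1 else 0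

lemma exists_inv (C : ℤ → ℤ → K) (C0 : ∀ r c, r < c → C r c = 0) (C1 : ∀ r, C r r = 1) :
    ∃ A, InvP C A := by
  have key : ∀ c : ℤ, ∃ x : ℤ → K, (∀ a < c, x a = 0) ∧
      ∀ a, c ≤ a → x a = (if a = c then 1 else 0) - ∑ k ∈ Finset.Ico c a, C a k * x k := by
    intro c
    refine exists_rec c (fun _ => 0)
      (fun a x => (if a = c then 1 else 0) - ∑ k ∈ Finset.Ico c a, C a k * x k) ?_
    intro a x x' h
    congr 1
    apply Finset.sum_congr rfl
    intro k hk
    rw [h k (Finset.mem_Ico.1 hk).2]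
  choose x hx0 hx using key
  refine ⟨fun r c => x c r, C0, C1, fun r c h => hx0 c r h, ?_, ?_⟩
  · intro r
    rw [hx r r le_rfl]; simp
  · intro r c lo hlo
    rcases lt_or_ge r c with hrc | hrc
    · rw [if_neg (by omega)]
      apply Finset.sum_eq_zero
      intro k hk
      rw [hx0 c k (by have := (Finset.mem_Icc.1 hk).2; omega), mul_zero]
    · have hs : Finset.Icc c r ⊆ Finset.Icc lo r := Finset.Icc_subset_Icc hlo le_rfl
      rw [← Finset.sum_subset hs]
      · rw [← Finset.Ico_insert_right hrc, Finset.sum_insert (by simp), C1, one_mul, hx c r hrc]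
        ring
      · intro k hk hk2
        rw [hx0 c k, mul_zero]
        rw [Finset.mem_Icc] at hk hk2
        omega

lemma InvP.CA' {C A : ℤ → ℤ → K} (h : InvP C A) (a b r c : ℤ) (hr : r ∈ Finset.Icc a b)
    (hc : c ∈ Finset.Icc a b) :
    ∑ k ∈ Finset.Icc a b, C r k * A k c = if r = c then 1 else 0 := by
  rw [Finset.mem_Icc] at hr hc
  rw [← h.CA r c a hc.1]
  symm
  apply Finset.sum_subset (Finset.Icc_subset_Icc le_rfl hr.2)
  intro k hk hk2
  rw [Finset.mem_Icc] at hk hk2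
  rw [h.C0 r k (by omega), zero_mul]

lemma InvP.AC {C A : ℤ → ℤ → K} (h : InvP C A) (a b r c : ℤ) (hr : r ∈ Finset.Icc a b)
    (hc : c ∈ Finset.Icc a b) :
    ∑ k ∈ Finset.Icc a b, A r k * C k c = if r = c then 1 else 0 := by
  set U := Finset.Icc a b
  have h1 : (Matrix.of fun i j : U => C i j) * (Matrix.of fun i j : U => A i j) = 1 := by
    ext i j
    rw [Matrix.mul_apply, Matrix.one_apply]
    simp only [Matrix.of_apply]
    rw [Finset.sum_coe_sort U (fun k => C i k * A k j), h.CA' a b i j i.2 j.2]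
    simp only [Subtype.ext_iff]
  rw [mul_eq_one_comm] at h1
  have h2 := congrFun (congrFun h1 ⟨r, hr⟩) ⟨c, hc⟩
  rw [Matrix.mul_apply, Matrix.one_apply] at h2
  simp only [Matrix.of_apply] at h2
  rw [Finset.sum_coe_sort U (fun k => A r k * C k c)] at h2
  rw [h2]
  simp only [Subtype.ext_iff]

lemma InvP.recover {C A : ℤ → ℤ → K} (h : InvP C A) (x : ℤ → K) (t s : ℤ) (hts : t ≤ s) :
    x s = ∑ r ∈ Finset.Icc t s, A s r * ∑ c ∈ Finset.Icc t s, C r c * x c := by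
  have hs : s ∈ Finset.Icc t s := Finset.mem_Icc.2 ⟨hts, le_rfl⟩
  simp only [Finset.mul_sum]
  rw [Finset.sum_comm, Finset.sum_eq_single s]
  · simp only [← mul_assoc]
    rw [← Finset.sum_mul, h.AC t s s s hs hs]; simp
  · intro c hc hne
    simp only [← mul_assoc]
    rw [← Finset.sum_mul, h.AC t s s c hs hc, if_neg (Ne.symm hne), zero_mul]
  · intro hh; exact absurd hs hh

lemma InvP.cramer {C A : ℤ → ℤ → K} (h : InvP C A) (a b : ℤ) (hab : b ≤ a) :
    A a b = (-1 : K) ^ (a + b) * minor C (Finset.Icc (b+1) a) (Finset.Icc b (a - 1)) := by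
  have := jacobi C A (fun _ => a) b a {b} (by simp [hab]) (by simp) (by simp [hab]) h.A0 h.A1
    (fun s hs c hc => h.AC b a s c hs hc) (by
      intro i _ r hr hlt
      have := (Finset.mem_Icc.1 hr).2
      omega)
  simp only [Finset.prod_singleton] at this
  rw [this]
  congr 1
  · apply nz_eq
    have : ({b} : Finset ℤ).filter (fun k => b < k ∧ a < a) = ∅ := by
      ext x; simp
    rw [this]
    refine ⟨-b, ?_⟩
    simp; ring
  · congr 1
    · ext x; simp; omega
    · ext x; simp; omega

section jug
variable {n : ℕ} {π : ℤ ≃ ℤ}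

lemma dual_apply (a : ℤ) : dualJug n π a = π.symm a + n := rfl

lemma sym_le (hπ : IsJuggling n π) (a : ℤ) : π.symm a ≤ a := by
  have := hπ.le_self (π.symm a); simpa using this

lemma le_sym (hπ : IsJuggling n π) (a : ℤ) : a ≤ π.symm a + n := by
  have := hπ.le_add (π.symm a); simpa using this

lemma sym_per (hπ : IsJuggling n π) (a : ℤ) : π.symm (a + n) = π.symm a + n := by
  rw [Equiv.symm_apply_eq, hπ.periodic]; simp

/-- the set `J` -/
noncomputable def Jset (n : ℕ) (π : ℤ ≃ ℤ) (a b : ℤ) : Finset ℤ :=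
  (Finset.Ioo a b).filter (fun i => dualJug n π i < b)

lemma main_ind (hπ : IsJuggling n π) {C A : ℤ → ℤ → K} (hC : IsFrieze n π C) (h : InvP C A)
    (d : ℕ) : ∀ a b : ℤ, a ≤ b → b < a + n → (b - a).toNat = d →
      ((dualJug n π a < b ∨ a + n < π b) → A b a = 0) ∧
      (dualJug n π a = b → A b a = (-1 : K) ^ (b - a + ((Jset n π a b).card : ℤ))) := by
  induction d using Nat.strong_induction_on with
  | _ d ih =>
  intro a b hab hbn hd
  have hleD : ∀ i, i ≤ dualJug n π i := fun i => by rw [dual_apply]; exact le_sym hπ i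
  set D := dualJug n π with hD
  set J := Jset n π a b with hJ
  have hmJ : ∀ i, i ∈ J ↔ (a < i ∧ i < b) ∧ D i < b := by
    intro i; simp [hJ, Jset, hD]
  have haJ : a ∉ J := by intro hh; have := (hmJ a).1 hh; omega
  set f : ℤ → ℤ := fun i => if i = a then b else D i with hf
  have hfa : f a = b := by simp [hf]
  have hfJ : ∀ i ∈ J, f i = D i := by
    intro i hi
    have : i ≠ a := fun e => haJ (e ▸ hi)
    simp [hf, this]
  have hIU : insert a J ⊆ Finset.Icc a b := by
    intro i hi
    rw [Finset.mem_insert] at hi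
    rw [Finset.mem_Icc]
    rcases hi with rfl | hi
    · omega
    · have := (hmJ i).1 hi; omega
  have key := jacobi C A f a b (insert a J) hIU (by
      intro i hi j hj hij
      simp only [Finset.coe_insert, Set.mem_insert_iff, Finset.mem_coe] at hi hj
      rcases hi with rfl | hi <;> rcases hj with rfl | hj
      · rfl
      · rw [hfa, hfJ j hj] at hij
        have := (hmJ j).1 hj; omega
      · rw [hfa, hfJ i hi] at hij
        have := (hmJ i).1 hi; omega
      · rw [hfJ i hi, hfJ j hj] at hij
        exact D.injective hij) (by
      intro i hi
      rw [Finset.mem_insert] at hi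
      rw [Finset.mem_Icc]
      rcases hi with rfl | hi
      · rw [hfa]; omega
      · rw [hfJ i hi]
        have := (hmJ i).1 hi
        have := hleD i
        omega) h.A0 h.A1 (fun s hs c hc => h.AC a b s c hs hc) (by
      intro i hi r hr hlt
      rw [Finset.mem_Icc] at hr
      rw [Finset.mem_insert] at hi
      rcases hi with rfl | hi
      · rw [hfa] at hlt; omega
      · rw [hfJ i hi] at hlt
        have h1 := (hmJ i).1 hi
        have h2 := hleD i
        exact (ih (r - i).toNat (by omega) i r (by omega) (by omega) rfl).1 (Or.inl hlt))
  rw [Finset.prod_insert haJ, Finset.prod_insert haJ, hfa] at key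
  have e1 : ∀ i ∈ J, A (f i) i = (-1 : K) ^ (f i - i +
      (((insert a J).filter (fun k => i < k ∧ f k < f i)).card : ℤ)) := by
    intro i hi
    have h1 := (hmJ i).1 hi
    have h2 := hleD i
    have h3 := (ih (D i - i).toNat (by omega) i (D i) h2 (by omega) rfl).2 rfl
    rw [hfJ i hi, h3]
    congr 4
    ext k
    simp only [Jset, Finset.mem_filter, Finset.mem_Ioo, Finset.mem_insert]
    constructor
    · rintro ⟨⟨h4, h5⟩, h6⟩
      have h6 : D k < D i := h6
      have hk : k ∈ J := (hmJ k).2 ⟨by omega, by omega⟩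
      refine ⟨Or.inr hk, h4, ?_⟩
      rw [hfJ k hk]; exact h6
    · rintro ⟨rfl | hk, h4, h5⟩
      · omega
      · rw [hfJ k hk] at h5
        have := hleD k
        exact ⟨⟨h4, by omega⟩, h5⟩
  rw [Finset.prod_congr rfl e1] at key
  have hne : (∏ i ∈ J, (-1 : K) ^ (f i - i +
      (((insert a J).filter (fun k => i < k ∧ f k < f i)).card : ℤ))) ≠ 0 := by
    rw [Finset.prod_ne_zero_iff]
    intro i _
    exact zpow_ne_zero _ (by simp)
  have e2 : (insert a J).filter (fun k => a < k ∧ f k < b) = J := by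
    ext k
    simp only [Finset.mem_filter, Finset.mem_insert]
    constructor
    · rintro ⟨rfl | hk, h4, h5⟩
      · omega
      · exact hk
    · intro hk
      have := (hmJ k).1 hk
      refine ⟨Or.inr hk, by omega, ?_⟩
      rw [hfJ k hk]; omega
  rw [e2] at key
  have e3 : (insert a J).image f = insert b (J.image D) := by
    rw [Finset.image_insert, hfa]
    congr 1
    exact Finset.image_congr (fun i hi => hfJ i hi)
  rw [e3] at key
  have key2 : A b a = (-1 : K) ^ (b - a + (J.card : ℤ)) *
      minor C (Finset.Icc a b \ insert a J) (Finset.Icc a b \ insert b (J.image D)) := by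
    apply mul_right_cancel₀ hne
    rw [key]; ring
  constructor
  · intro hT
    have ht := hC.2.2 a b (by
      rcases hT with h1 | h1
      · exact Or.inl ⟨h1, hbn⟩
      · exact Or.inr ⟨hbn, h1⟩)
    rw [key2]
    have s1 : Finset.Icc a b \ insert a J = Finset.Ioc a b \ J := by
      ext x
      simp only [Finset.mem_sdiff, Finset.mem_insert, Finset.mem_Icc, Finset.mem_Ioc]
      constructor
      · rintro ⟨h1, h2⟩; push Not at h2; exact ⟨by omega, h2.2⟩
      · rintro ⟨h1, h2⟩; exact ⟨by omega, by push Not; exact ⟨by omega, h2⟩⟩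
    have s2 : Finset.Icc a b \ insert b (J.image D) = Finset.Ico a b \ J.image D := by
      ext x
      simp only [Finset.mem_sdiff, Finset.mem_insert, Finset.mem_Icc, Finset.mem_Ico]
      constructor
      · rintro ⟨h1, h2⟩; rw [not_or] at h2; exact ⟨by omega, h2.2⟩
      · rintro ⟨h1, h2⟩; exact ⟨by omega, by rw [not_or]; exact ⟨by omega, h2⟩⟩
    rw [s1, s2]
    have ht' : minor C (Finset.Ioc a b \ J) (Finset.Ico a b \ J.image D) = 0 := ht
    rw [ht', mul_zero]
  · intro hF
    have hpb : π b = a + n := by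
      rw [← hF, hD, dual_apply, hπ.periodic]; simp
    have hfr := hC.2.1 a b (le_of_eq hF) hbn (le_of_eq hpb.symm)
    have s1 : (Finset.Icc a b).filter (fun i => dualJug n π i ≤ b) = insert a J := by
      ext x
      simp only [Finset.mem_filter, Finset.mem_insert, Finset.mem_Icc, hmJ]
      rw [← hD]
      constructor
      · rintro ⟨h1, h2⟩
        by_cases hx : x = a
        · exact Or.inl hx
        · right
          have : D x ≠ b := fun e => hx (D.injective (e.trans hF.symm))
          have := hleD x
          omega
      · rintro (rfl | h1)
        · omega
        · omega
    rw [s1, Finset.image_insert, ← hD, hF] at hfr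
    rw [key2, hfr, mul_one]
end jug

section jug2
variable {n : ℕ} {π : ℤ ≃ ℤ}

lemma window (n : ℕ) (hn : 0 < n) (g : ℤ → ℤ) (hg : ∀ i, g (i + n) = g i) (t : ℤ) :
    ∑ i ∈ Finset.Ioc t (t + n), g i = ∑ i ∈ Finset.Ioc (0:ℤ) (0 + n), g i := by
  have step : ∀ t : ℤ, ∑ i ∈ Finset.Ioc t (t + n), g i
      = ∑ i ∈ Finset.Ioc (t+1) (t + 1 + n), g i := by
    intro t
    have h1 : Finset.Ioc t (t + n) = insert (t+1) (Finset.Ioc (t+1) (t+n)) := by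
      ext x; simp only [Finset.mem_Ioc, Finset.mem_insert]; omega
    have h2 : Finset.Ioc (t+1) (t + 1 + n) = insert (t+1+n) (Finset.Ioc (t+1) (t+n)) := by
      ext x; simp only [Finset.mem_Ioc, Finset.mem_insert]; omega
    rw [h1, h2, Finset.sum_insert (by simp), Finset.sum_insert (by simp), hg]
  induction t using Int.induction_on with
  | zero => rfl
  | succ i ih => rw [← step, ih]
  | pred i ih =>
    rw [step, ← ih]
    simp

lemma balls_const (hπ : IsJuggling n π) {h : ℕ} (hb : HasBalls n π h) (t : ℤ) :
    ((Finset.Ioc t (t+n)).filter (fun j => π.symm j ≤ t)).card = h := by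
  have hn := hπ.npos
  set U := Finset.Ioc t (t+n) with hU
  have h0 : ∑ i ∈ U, (π i - i) = (h : ℤ) * n := by
    rw [hU, window n hn (fun i => π i - i) (fun i => by rw [hπ.periodic]; ring) t, ← hb]
    apply Finset.sum_congr _ (fun _ _ => rfl)
    ext x; simp only [Finset.mem_Ioc, Finset.mem_Icc]; omega
  set r : ℤ → ℤ := fun i => if π i ≤ t + n then π i else π i - n with hr
  have hrU : ∀ i ∈ U, r i ∈ U := by
    intro i hi
    rw [hU, Finset.mem_Ioc] at hi ⊢
    have h1 := hπ.le_self i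
    have h2 := hπ.le_add i
    simp only [hr]
    split_ifs <;> omega
  have hinj : Set.InjOn r U := by
    intro i hi j hj hij
    have hi := Finset.mem_Ioc.1 hi
    have hj := Finset.mem_Ioc.1 hj
    have hpn : ∀ i, π (i - n) = π i - n := by
      intro i
      have := hπ.periodic (i - n)
      rw [sub_add_cancel] at this
      omega
    simp only [hr] at hij
    split_ifs at hij with h1 h2 h2
    · exact π.injective hij
    · rw [← hpn] at hij
      have := π.injective hij
      omega
    · rw [← hpn] at hij
      have := π.injective hij
      omega
    · exact π.injective (by omega)
  have himg : U.image r = U := by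
    apply Finset.eq_of_subset_of_card_le
    · intro x hx
      obtain ⟨i, hi, rfl⟩ := Finset.mem_image.1 hx
      exact hrU i hi
    · rw [Finset.card_image_of_injOn hinj]
  have hsum : ∑ i ∈ U, r i = ∑ i ∈ U, i := by
    conv_rhs => rw [← himg]
    rw [Finset.sum_image hinj]
  have hri : ∀ i, r i = π i - (if t + n < π i then (n : ℤ) else 0) := by
    intro i
    simp only [hr]
    split_ifs <;> omega
  have h2 : ((U.filter (fun i => t + n < π i)).card : ℤ) * n = (h : ℤ) * n := by
    rw [← h0, Finset.sum_sub_distrib, ← hsum]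
    simp only [hri]
    rw [Finset.sum_sub_distrib, ← Finset.sum_filter, Finset.sum_const, nsmul_eq_mul]
    ring
  have h3 : ((U.filter (fun i => t + n < π i)).card : ℤ) = h := by
    apply mul_right_cancel₀ _ h2
    exact_mod_cast hn.ne'
  have h4 : (U.filter (fun i => t + n < π i)).card = (U.filter (fun j => π.symm j ≤ t)).card := by
    apply Finset.card_bij (fun i _ => π i - n)
    · intro i hi
      rw [Finset.mem_filter, hU, Finset.mem_Ioc] at hi ⊢
      have h1 := hπ.le_add i
      have h5 := sym_per hπ (π i - n)
      rw [sub_add_cancel, Equiv.symm_apply_apply] at h5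
      omega
    · intro i _ j _ hij
      exact π.injective (by omega)
    · intro j hj
      rw [Finset.mem_filter, hU, Finset.mem_Ioc] at hj
      have h5 := le_sym hπ j
      refine ⟨π.symm j + n, ?_, ?_⟩
      · rw [Finset.mem_filter, hU, Finset.mem_Ioc, hπ.periodic, Equiv.apply_symm_apply]
        omega
      · rw [hπ.periodic, Equiv.apply_symm_apply]; ring
  rw [h4] at h3
  exact_mod_cast h3

lemma sign_id (hπ : IsJuggling n π) {h : ℕ} (hb : HasBalls n π h) (a : ℤ) :
    ((Jset n π (π a) (a + n)).card : ℤ) - (Set.ncard {i : ℤ | a < i ∧ π i < π a} : ℤ)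
      = h - (π a - a) := by
  have hH := balls_const hπ hb a
  set b := π a with hbdef
  have hab : a ≤ b := hπ.le_self a
  have hban : b ≤ a + n := hπ.le_add a
  have hqb : π.symm b = a := by simp [hbdef]
  have e1 : Jset n π b (a+n) = (Finset.Ioc b (a+n)).filter (fun j => π.symm j ≤ a) := by
    ext j
    simp only [Jset, Finset.mem_filter, Finset.mem_Ioo, Finset.mem_Ioc]
    rw [dual_apply]
    constructor
    · rintro ⟨h1, h2⟩; omega
    · rintro ⟨h1, h2⟩
      have h3 : π.symm j ≠ a := by
        intro h3
        have := π.symm.injective (h3.trans hqb.symm)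
        omega
      have := le_sym hπ j
      omega
  have e2 : Set.ncard {i : ℤ | a < i ∧ π i < b}
      = ((Finset.Ioc a b).filter (fun j => ¬ π.symm j ≤ a)).card := by
    have : {i : ℤ | a < i ∧ π i < b} =
        ↑(((Finset.Ioc a b).filter (fun j => ¬ π.symm j ≤ a)).image π.symm) := by
      ext i
      simp only [Set.mem_ofPred_eq, Finset.coe_image, Finset.coe_filter, Set.mem_image,
        Finset.mem_Ioc]
      constructor
      · rintro ⟨h1, h2⟩
        refine ⟨π i, ⟨⟨?_, h2.le⟩, ?_⟩, by simp⟩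
        · have := hπ.le_self i; omega
        · simp; omega
      · rintro ⟨j, ⟨h1, h2⟩, rfl⟩
        rw [Equiv.apply_symm_apply]
        refine ⟨by omega, ?_⟩
        rcases lt_or_eq_of_le h1.2 with h3 | h3
        · exact h3
        · rw [h3, hqb] at h2; omega
    rw [this, Set.ncard_coe_finset, Finset.card_image_of_injective _ π.symm.injective]
  have e3 := Finset.card_filter_add_card_filter_not (s := Finset.Ioc a b)
    (fun j => π.symm j ≤ a)
  rw [Int.card_Ioc] at e3
  have e4 : (Finset.Ioc a (a+n)).filter (fun j => π.symm j ≤ a)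
      = (Finset.Ioc a b).filter (fun j => π.symm j ≤ a) ∪
        (Finset.Ioc b (a+n)).filter (fun j => π.symm j ≤ a) := by
    rw [← Finset.filter_union, Finset.Ioc_union_Ioc_eq_Ioc hab hban]
  rw [e4, Finset.card_union_of_disjoint] at hH
  · rw [e1, e2]
    omega
  · apply Finset.disjoint_filter_filter
    rw [Finset.disjoint_left]
    intro x h1 h2
    rw [Finset.mem_Ioc] at h1 h2
    omega

lemma row_sum (hC : IsPrefrieze π C) (x : ℤ → K) (a lo hi : ℤ) (hlo : lo ≤ π.symm a)
    (hhi : a ≤ hi) :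
    ∑ᶠ b : ℤ, C a b * x b = ∑ b ∈ Finset.Icc lo hi, C a b * x b := by
  apply finsum_eq_sum_of_support_subset
  intro b hb
  rw [Function.mem_support] at hb
  by_contra hcon
  apply hb
  rw [(hC a b).2.2, zero_mul]
  right
  rw [Finset.mem_coe, Finset.mem_Icc] at hcon
  omega

lemma superper (hπ : IsJuggling n π) {h : ℕ} (hb : HasBalls n π h) {C A : ℤ → ℤ → K}
    (hC : IsFrieze n π C) (hI : InvP C A) (x : ℤ → K) (hx : SolvesRec C x) (a : ℤ) :
    x (a + n) = (-1 : K) ^ ((n : ℤ) - h - 1) * x a := by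
  have hn := hπ.npos
  rcases eq_or_lt_of_le (hπ.le_self a) with hfix | hlt
  · have hz : ∀ c, π c = c → x c = 0 := by
      intro c hc
      have h1 := hx c
      have h2 : π.symm c = c := by rw [Equiv.symm_apply_eq, hc]
      rw [row_sum hC.1 x c c c (by omega) le_rfl] at h1
      simpa [hI.C1] using h1
    rw [hz a hfix.symm, hz (a+n) (by rw [hπ.periodic, ← hfix]), mul_zero]
  · have h1 := hI.recover x (a+1) (a+n) (by omega)
    rw [Finset.sum_eq_single (π a)] at h1
    · have h2 : ∑ c ∈ Finset.Icc (a+1) (a+n), C (π a) c * x c = - (C (π a) a * x a) := by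
        have h3 := hx (π a)
        rw [row_sum hC.1 x (π a) a (a+n) (by simp) (hπ.le_add a)] at h3
        have h4 : Finset.Icc a (a+n) = insert a (Finset.Icc (a+1) (a+n)) := by
          ext y; simp only [Finset.mem_insert, Finset.mem_Icc]; omega
        rw [h4, Finset.sum_insert (by simp)] at h3
        linear_combination h3
      have hDa : dualJug n π (π a) = a + n := by rw [dual_apply]; simp
      have h5 := (main_ind hπ hC hI _ (π a) (a + n) (hπ.le_add a) (by omega) rfl).2 hDa
      have h6 := (hC.1 (π a) a).2.1 rfl
      have h7 := sign_id hπ hb a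
      rw [h1, h2, h5, h6, ← zpow_natCast]
      have h8 : ∀ p q : ℤ, (-1 : K) ^ p * -((-1 : K) ^ q * x a) = (-1 : K) ^ (p + q + 1) * x a := by
        intro p q
        rw [zpow_add₀ (by simp), zpow_add₀ (by simp), zpow_one]; ring
      rw [h8]
      congr 1
      apply nz_eq
      refine ⟨(Set.ncard {i : ℤ | a < i ∧ π i < π a} : ℤ) + h - (π a - a) + 1, ?_⟩
      omega
    · intro r hr hne
      rw [Finset.mem_Icc] at hr
      rcases lt_trichotomy (π.symm r) a with h2 | h2 | h2
      · rw [(main_ind hπ hC hI _ r (a + n) (by omega) (by omega) rfl).1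
          (Or.inl (by rw [dual_apply]; omega)), zero_mul]
      · exact absurd (by rw [← h2]; simp) hne
      · rw [← row_sum hC.1 x r (a+1) (a+n) (by omega) (by omega), hx r, mul_zero]
    · intro hh
      exact absurd (Finset.mem_Icc.2 ⟨by omega, hπ.le_add a⟩) hh

lemma sp_zero (hn : 0 < n) (ε : K) (hε : ε ≠ 0) (x : ℤ → K) (hx : ∀ a, x (a + n) = ε * x a) (b : ℤ)
    (h0 : ∀ a, b ≤ a → a < b + n → x a = 0) (a : ℤ) : x a = 0 := by
  have hk : ∀ (k : ℤ) (a : ℤ), x (a + k * n) = 0 ↔ x a = 0 := by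
    have h1 : ∀ a, x (a + n) = 0 ↔ x a = 0 := by
      intro a; rw [hx]; simp [hε]
    intro k
    induction k using Int.induction_on with
    | zero => simp
    | succ i ih =>
      intro a
      rw [← ih a, ← h1 (a + i * n)]
      ring_nf
    | pred i ih =>
      intro a
      rw [← ih a, ← h1 (a + (-(i:ℤ) - 1) * n)]
      ring_nf
  rw [← hk (-((a - b) / n)) a]
  have h1 := Int.emod_add_mul_ediv (a - b) n
  have h2 := Int.emod_nonneg (a - b) (show (n : ℤ) ≠ 0 by omega)
  have h3 := Int.emod_lt_of_pos (a - b) (show (0:ℤ) < n by omega)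
  have h4 : a + -((a - b) / n) * n = b + (a - b) % n := by linarith
  apply h0 <;> omega

lemma exists_back (hπ : IsJuggling n π) {C : ℤ → ℤ → K} (hC : IsPrefrieze π C) (p : ℤ)
    (y : ℤ → K) : ∃ x : ℤ → K, (∀ a, p < a → x a = y a) ∧
      ∀ r, π.symm r ≤ p → ∑ᶠ c : ℤ, C r c * x c = 0 := by
  obtain ⟨x, hx1, hx2⟩ := exists_rec (-p) (fun a => y (-a))
    (fun a z => - (C (π (-a)) (-a))⁻¹ * ∑ c ∈ Finset.Ioc (-a) (π (-a)), C (π (-a)) c * z (-c)) (by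
      intro a z z' h
      congr 1
      apply Finset.sum_congr rfl
      intro c hc
      rw [h (-c) (by have := (Finset.mem_Ioc.1 hc).1; omega)])
  refine ⟨fun a => x (-a), ?_, ?_⟩
  · intro a ha
    change x (-a) = y a
    rw [hx1 (-a) (by omega), neg_neg]
  · intro r hr
    set a := π.symm r with ha
    have hra : π a = r := by simp [ha]
    have har : a ≤ r := by rw [← hra]; exact hπ.le_self a
    rw [row_sum hC _ r a r le_rfl le_rfl, ← Finset.Ioc_insert_left har, Finset.sum_insert (by simp)]
    have h1 := hx2 (-a) (by omega)
    simp only [neg_neg, hra] at h1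
    rw [h1]
    have h2 : C r a ≠ 0 := by
      rw [(hC r a).2.1 hra.symm]
      exact pow_ne_zero _ (by simp)
    field_simp
    ring

lemma exists_kcol (hπ : IsJuggling n π) {C A : ℤ → ℤ → K} (hC : IsPrefrieze π C) (hI : InvP C A)
    (b : ℤ) : ∃ x : ℤ → K, (∀ a, π.symm b < a → x a = A a b) ∧ SolvesRec C x := by
  obtain ⟨x, hx1, hx2⟩ := exists_back hπ hC (π.symm b) (fun a => A a b)
  refine ⟨x, hx1, ?_⟩
  intro r
  rcases le_or_gt (π.symm r) (π.symm b) with h | h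
  · exact hx2 r h
  · rw [row_sum hC x r (π.symm b + 1) r (by omega) le_rfl]
    have hrb : r ≠ b := by rintro rfl; omega
    have h1 := hI.CA r b (min b (π.symm b + 1)) (min_le_left _ _)
    rw [if_neg hrb] at h1
    have h2 : ∑ c ∈ Finset.Icc (π.symm b + 1) r, C r c * x c
        = ∑ c ∈ Finset.Icc (π.symm b + 1) r, C r c * A c b := by
      apply Finset.sum_congr rfl
      intro c hc
      rw [hx1 c (by have := (Finset.mem_Icc.1 hc).1; omega)]
    rw [h2, ← h1]
    apply Finset.sum_subset (Finset.Icc_subset_Icc (min_le_right _ _) le_rfl)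
    intro c hc hc2
    rw [Finset.mem_Icc] at hc hc2
    rw [(hC r c).2.2 (Or.inr (by omega)), zero_mul]

end jug2

/-- **Superperiodic solutions of a juggler's frieze.** Let `C` be a `π`-frieze (with `π`
of period `n` and `h` balls).  For each `b` with `b < π b`, the unique sequence `x`
with `x a = (-1)^(a+b) * C† a b` for `b ≤ a < b + n` and `x (a+n) = (-1)^(n-h-1) * x a`
is a solution of `C x = 0`; moreover, these solutions span the space of solutions. -/
theorem frieze_solutions_span (n h : ℕ) (π : ℤ ≃ ℤ) (hπ : IsJuggling n π)
    (hballs : HasBalls n π h) (C : ℤ → ℤ → K) (hC : IsFrieze n π C) :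
    (∀ b : ℤ, b < π b → ∀ x : ℤ → K,
        (∀ a : ℤ, b ≤ a → a < b + n → x a = (-1 : K) ^ (a + b) * dualMat n h π C a b) →
        (∀ a : ℤ, x (a + n) = (-1 : K) ^ ((n : ℤ) - h - 1) * x a) →
        SolvesRec C x) ∧
    (Submodule.span K {x : ℤ → K | ∃ b : ℤ, b < π b ∧
        (∀ a : ℤ, b ≤ a → a < b + n → x a = (-1 : K) ^ (a + b) * dualMat n h π C a b) ∧
        (∀ a : ℤ, x (a + n) = (-1 : K) ^ ((n : ℤ) - h - 1) * x a)} : Set (ℤ → K))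
      = {x : ℤ → K | SolvesRec C x} := by
  have hn := hπ.npos
  have hpre := hC.1
  have C0 : ∀ r c, r < c → C r c = 0 := fun r c hrc => (hpre r c).2.2 (Or.inl (by omega))
  have C1 : ∀ r, C r r = 1 := fun r => (hpre r r).1 rfl
  obtain ⟨A, hI⟩ := exists_inv C C0 C1
  have hε : (-1 : K) ^ ((n : ℤ) - h - 1) ≠ 0 := zpow_ne_zero _ (by simp)
  have hdual : ∀ a b : ℤ, b ≤ a → a < b + n →
      (-1 : K) ^ (a + b) * dualMat n h π C a b = A a b := by
    intro a b h1 h2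
    rw [hI.cramer a b h1, dualMat, if_pos ⟨h1, h2⟩]
  have hsb : ∀ b : ℤ, b < π b → π.symm b < b := by
    intro b hb
    rcases lt_or_eq_of_le (sym_le hπ b) with h1 | h1
    · exact h1
    · rw [Equiv.symm_apply_eq] at h1; omega
  choose k hk1 hk2 using fun b => exists_kcol hπ hpre hI b
  have hksp : ∀ b a, k b (a + n) = (-1 : K) ^ ((n : ℤ) - h - 1) * k b a := fun b a =>
    superper hπ hballs hC hI (k b) (hk2 b) a
  have hext : ∀ (x z : ℤ → K) (b : ℤ),
      (∀ a : ℤ, x (a + n) = (-1 : K) ^ ((n : ℤ) - h - 1) * x a) →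
      (∀ a : ℤ, z (a + n) = (-1 : K) ^ ((n : ℤ) - h - 1) * z a) →
      (∀ a, b ≤ a → a < b + n → x a = z a) → x = z := by
    intro x z b hx hz hxz
    funext a
    have := sp_zero hn _ hε (fun a => x a - z a)
      (fun a => by simp only [hx, hz]; ring) b
      (fun a h1 h2 => by simp only [hxz a h1 h2, sub_self]) a
    exact sub_eq_zero.1 this
  have part1 : ∀ b : ℤ, b < π b → ∀ x : ℤ → K,
        (∀ a : ℤ, b ≤ a → a < b + n → x a = (-1 : K) ^ (a + b) * dualMat n h π C a b) →
        (∀ a : ℤ, x (a + n) = (-1 : K) ^ ((n : ℤ) - h - 1) * x a) →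
        SolvesRec C x := by
    intro b hb x hx1 hx2
    have : x = k b := hext x (k b) b hx2 (hksp b) (fun a h1 h2 => by
      rw [hx1 a h1 h2, hdual a b h1 h2, hk1 b a (by have := hsb b hb; omega)])
    rw [this]
    exact hk2 b
  refine ⟨part1, ?_⟩
  apply Set.Subset.antisymm
  · intro x hx
    change SolvesRec C x
    have hx' : x ∈ Submodule.span K _ := hx
    clear hx
    induction hx' using Submodule.span_induction with
    | mem x hx =>
      obtain ⟨b, hb, h1, h2⟩ := hx
      exact part1 b hb x h1 h2
    | zero => intro a; simp
    | add x y hx hy ihx ihy =>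
      intro a
      have h1 := ihx a
      have h2 := ihy a
      rw [row_sum hpre _ a _ a le_rfl le_rfl] at h1 h2 ⊢
      simp only [Pi.add_apply, mul_add]
      rw [Finset.sum_add_distrib, h1, h2, add_zero]
    | smul c x hx ihx =>
      intro a
      have h1 := ihx a
      rw [row_sum hpre _ a _ a le_rfl le_rfl] at h1 ⊢
      simp only [Pi.smul_apply, smul_eq_mul, mul_left_comm _ c]
      rw [← Finset.mul_sum, h1, mul_zero]
  · intro x hx
    have hx : SolvesRec C x := hx
    set B := (Finset.Ico (0:ℤ) n).filter (fun r => π.symm r < 0) with hB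
    have hxk : x = ∑ r ∈ B, (∑ c ∈ Finset.Icc 0 r, C r c * x c) • k r := by
      apply hext x _ 0 (superper hπ hballs hC hI x hx)
      · intro a
        simp only [Finset.sum_apply, Pi.smul_apply, smul_eq_mul, hksp]
        rw [Finset.mul_sum]
        apply Finset.sum_congr rfl
        intro r _
        ring
      · intro s h1 h2
        rw [zero_add] at h2
        rw [Finset.sum_apply]
        have hrec := hI.recover x 0 s h1
        have e1 : ∀ r ∈ B, ((∑ c ∈ Finset.Icc 0 r, C r c * x c) • k r) s
            = A s r * ∑ c ∈ Finset.Icc 0 r, C r c * x c := by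
          intro r hr
          have := (Finset.mem_filter.1 hr).2
          rw [Pi.smul_apply, smul_eq_mul, hk1 r s (by omega), mul_comm]
        have e2 : ∀ r ∈ Finset.Icc 0 s, A s r * ∑ c ∈ Finset.Icc 0 s, C r c * x c
            = A s r * ∑ c ∈ Finset.Icc 0 r, C r c * x c := by
          intro r hr
          rw [Finset.mem_Icc] at hr
          congr 1
          symm
          apply Finset.sum_subset (Finset.Icc_subset_Icc le_rfl hr.2)
          intro c hc hc2
          rw [Finset.mem_Icc] at hc hc2
          rw [C0 r c (by omega), zero_mul]
        rw [Finset.sum_congr rfl e1]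
        rw [Finset.sum_congr rfl e2] at hrec
        rw [hrec]
        have e3 : Finset.Icc 0 s ⊆ Finset.Ico (0:ℤ) n := by
          intro r hr
          rw [Finset.mem_Icc] at hr
          rw [Finset.mem_Ico]; omega
        rw [Finset.sum_subset e3]
        · symm
          apply Finset.sum_subset (Finset.filter_subset _ _)
          intro r hr hrB
          have h3 : 0 ≤ π.symm r := by
            by_contra hcon
            exact hrB (Finset.mem_filter.2 ⟨hr, by omega⟩)
          rw [← row_sum hpre x r 0 r h3 le_rfl, hx r, mul_zero]
        · intro r hr hr2
          rw [Finset.mem_Ico] at hr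
          rw [Finset.mem_Icc] at hr2
          rw [hI.A0 s r (by omega), zero_mul]
    rw [hxk]
    apply Submodule.sum_mem
    intro r hr
    apply Submodule.smul_mem
    apply Submodule.subset_span
    have hr1 := Finset.mem_Ico.1 (Finset.mem_filter.1 hr).1
    have hr2 := (Finset.mem_filter.1 hr).2
    refine ⟨r, ?_, ?_, hksp r⟩
    · rcases lt_or_eq_of_le (hπ.le_self r) with h1 | h1
      · exact h1
      · have : π.symm r = r := by rw [Equiv.symm_apply_eq]; exact h1
        omega
    · intro a h1 h2
      rw [hdual a r h1 h2, hk1 r a (by omega)]
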